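/- (Update identity (12), Oja class.) Let W be an N×L complex matrix with Wᴴ W = I_L, x ∈ ℂ^N, q = Wᴴ x, y = W q, p = x − y, and assume q ≠ 0. Let β be any real number, and let Q be an L×L unitary matrix whose first column equals q/‖q‖. Then the matrix T = (W + β • (p qᴴ)) Q, where p qᴴ is the outer product of the column p with the conjugated row of q, satisfies: the first column of T equals y/‖y‖ + (β ‖q‖) • p, and for every column index j other than the first, the j-th column of T equals the j-th column of W Q. -/

import Mathlib

open Matrix

lemma norm_eq_of_conjTranspose_mul_self {N L : ℕ} {W : Matrix (Fin N) (Fin L) ℂ}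
    (hW : Wᴴ * W = 1) {q : EuclideanSpace ℂ (Fin L)} {y : EuclideanSpace ℂ (Fin N)}
    (hy : (y : Fin N → ℂ) = W *ᵥ q) : ‖y‖ = ‖q‖ := by
  have h : inner ℂ y y = inner ℂ q q := by
    rw [EuclideanSpace.inner_eq_star_dotProduct, EuclideanSpace.inner_eq_star_dotProduct,
      dotProduct_comm, dotProduct_comm _ (star _)]
    rw [hy, star_mulVec, ← dotProduct_mulVec, mulVec_mulVec, hW, one_mulVec]
  rw [inner_self_eq_norm_sq_to_K, inner_self_eq_norm_sq_to_K] at h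
  exact (sq_eq_sq₀ (norm_nonneg _) (norm_nonneg _)).1 (by exact_mod_cast h)

lemma sum_star_mul_of_col_eq_normalized {L : ℕ} {Q : Matrix (Fin L) (Fin L) ℂ}
    (hQ : Qᴴ * Q = 1) {q : EuclideanSpace ℂ (Fin L)} (hq0 : q ≠ 0) {j₀ : Fin L}
    (hQ0 : ∀ i, Q i j₀ = q i / (‖q‖ : ℂ)) (j : Fin L) :
    ∑ k, star (q k) * Q k j = if j₀ = j then (‖q‖ : ℂ) else 0 := by
  have hn : (‖q‖ : ℂ) ≠ 0 := by simpa using hq0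
  have hs : ∀ k, star (q k) = (‖q‖ : ℂ) * star (Q k j₀) := fun k => by
    rw [hQ0, star_div₀, Complex.star_def, Complex.conj_ofReal]
    field_simp
  have h := congrFun (congrFun hQ j₀) j
  simp only [mul_apply, conjTranspose_apply, one_apply] at h
  simp only [hs, mul_assoc, ← Finset.mul_sum, h, mul_ite, mul_one, mul_zero]

theorem stmt_7 (N L : ℕ) (hL : 1 ≤ L) (W : Matrix (Fin N) (Fin L) ℂ)
    (hW : Wᴴ * W = 1) (x : EuclideanSpace ℂ (Fin N))
    (q : EuclideanSpace ℂ (Fin L)) (hq : q = Wᴴ.mulVec x)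
    (y : EuclideanSpace ℂ (Fin N)) (hy : y = W.mulVec q)
    (p : EuclideanSpace ℂ (Fin N)) (hp : p = x - y)
    (hq0 : q ≠ 0) (β : ℝ)
    (Q : Matrix (Fin L) (Fin L) ℂ) (hQ : Qᴴ * Q = 1)
    (hQ0 : (fun i => Q i ⟨0, hL⟩) = fun i => q i / (‖q‖ : ℂ))
    (T : Matrix (Fin N) (Fin L) ℂ)
    (hT : T = (W + (β : ℂ) • Matrix.of (fun i j => p i * star (q j))) * Q) :
    (fun i => T i ⟨0, hL⟩) = (fun i => y i / (‖y‖ : ℂ) + ((β * ‖q‖ : ℝ) : ℂ) * p i) ∧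
      ∀ j : Fin L, j ≠ ⟨0, hL⟩ → (fun i => T i j) = fun i => (W * Q) i j := by
  have hc := sum_star_mul_of_col_eq_normalized hQ hq0 (congrFun hQ0)
  have hTij : ∀ i j, T i j = (W * Q) i j +
      β * p i * (if (⟨0, hL⟩ : Fin L) = j then (‖q‖ : ℂ) else 0) := fun i j => by
    rw [← hc, hT, Matrix.add_mul, Matrix.add_apply, Matrix.smul_mul, Matrix.smul_apply,
      mul_apply (M := Matrix.of _)]
    simp only [of_apply, smul_eq_mul, mul_assoc, ← Finset.mul_sum]
  refine ⟨funext fun i => ?_, fun j hj => funext fun i => ?_⟩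
  · have hWQ : (W * Q) i ⟨0, hL⟩ = y i / (‖q‖ : ℂ) := by
      rw [hy, mul_apply, mulVec, dotProduct, Finset.sum_div]
      exact Finset.sum_congr rfl fun k _ => by rw [congrFun hQ0 k, mul_div_assoc]
    rw [hTij, hWQ, norm_eq_of_conjTranspose_mul_self hW hy, if_pos rfl]
    push_cast
    ring
  · rw [hTij, if_neg hj.symm, mul_zero, add_zero]
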